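/- Let n ≥ 1 and let ψ : Fin n → ℝ. Define the n × n real matrix A by: for each row index i with i + 1 < n, A i i = ψ i, A i (i+1) = −ψ (i+1), and A i j = 0 for all other columns j; and the last row of A has every entry equal to 1. Then det A = ∑_{j=0}^{n−1} ∏_{i ≠ j} ψ i. In particular, if ψ i > 0 for all i, then det A = (∏_i ψ i) · (∑_i 1/ψ i) > 0. -/

import Mathlib

/-- The `n × n` matrix `Ψ̃` of (54): bidiagonal rows `A i i = ψ i`,
`A i (i+1) = −ψ (i+1)` (zero elsewhere) for `i + 1 < n`, and a last row of ones. -/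
noncomputable def bidiagWithOnesRow (n : ℕ) (ψ : Fin n → ℝ) : Matrix (Fin n) (Fin n) ℝ :=
  Matrix.of fun i j =>
    if (i : ℕ) + 1 < n then
      if j = i then ψ i
      else if (j : ℕ) = (i : ℕ) + 1 then -ψ j
      else 0
    else 1

theorem aux_erase {n : ℕ} (ψ : Fin n → ℝ) (j : Fin n) :
    ∏ i ∈ Finset.univ.erase j, ψ i = ∏ i, if i = j then 1 else ψ i := by
  rw [← Finset.mul_prod_erase Finset.univ _ (Finset.mem_univ j)]
  simp only [if_true, one_mul]
  apply Finset.prod_congr rfl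
  intro i hi
  rw [if_neg (Finset.ne_of_mem_erase hi)]

theorem aux_rhs {n : ℕ} (ψ : Fin (n + 1) → ℝ) :
    (∑ j, ∏ i ∈ Finset.univ.erase j, ψ i) =
      (∏ i : Fin n, ψ i.succ) + ψ 0 * ∑ j, ∏ i ∈ Finset.univ.erase j, ψ (Fin.succ i) := by
  have h := fun j : Fin n => aux_erase (fun i => ψ (Fin.succ i)) j
  simp only [h, aux_erase]
  rw [Fin.sum_univ_succ, Finset.mul_sum]
  congr 1
  · simp [Fin.prod_univ_succ]
  · apply Finset.sum_congr rfl
    intro j _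
    simp [Fin.prod_univ_succ, (Fin.succ_ne_zero j).symm]

theorem aux_tri {n : ℕ} (ψ : Fin (n + 2) → ℝ) :
    ((bidiagWithOnesRow (n + 2) ψ).submatrix (Fin.last (n + 1)).succAbove Fin.succ).det =
      (-1) ^ (n + 1) * ∏ i : Fin (n + 1), ψ i.succ := by
  rw [Matrix.det_of_lowerTriangular]
  · have : ∀ i : Fin (n + 1), (bidiagWithOnesRow (n + 2) ψ).submatrix
        (Fin.last (n + 1)).succAbove Fin.succ i i = (-1) * ψ i.succ := by
      intro i
      have := i.2
      simp [bidiagWithOnesRow, Fin.ext_iff]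
      intro h
      omega
    simp only [this, Finset.prod_mul_distrib]
    simp
  · intro i j hij
    have hij : i < j := hij
    have hij : (i : ℕ) < j := hij
    have := i.2
    simp only [bidiagWithOnesRow, Fin.ext_iff, Matrix.submatrix_apply, Matrix.of_apply,
      Fin.succAbove_last, Fin.val_castSucc, Fin.val_succ]
    rw [if_pos (by omega), if_neg (by omega), if_neg (by omega)]

theorem aux_det {n : ℕ} (ψ : Fin (n + 1) → ℝ) :
    (bidiagWithOnesRow (n + 1) ψ).det = ∑ j, ∏ i ∈ Finset.univ.erase j, ψ i := by
  induction n with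
  | zero => simp [bidiagWithOnesRow]
  | succ n ih =>
    rw [aux_rhs, ← ih, Matrix.det_succ_column_zero, Fin.sum_univ_succ, Fin.sum_univ_castSucc]
    rw [Finset.sum_eq_zero, Fin.succ_last, aux_tri]
    · have e : (bidiagWithOnesRow (n + 2) ψ).submatrix (Fin.succAbove 0) Fin.succ =
          bidiagWithOnesRow (n + 1) (fun i => ψ i.succ) := by
        ext i j
        simp [bidiagWithOnesRow, Fin.ext_iff]
      have e0 : bidiagWithOnesRow (n + 2) ψ 0 0 = ψ 0 := by simp [bidiagWithOnesRow]
      have e1 : bidiagWithOnesRow (n + 2) ψ (Fin.last (n + 1)) 0 = 1 := by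
        simp [bidiagWithOnesRow]
      rw [e, e0, e1]
      have : ((-1 : ℝ) ^ (n + 1)) * (-1) ^ (n + 1) = 1 := by
        rw [← mul_pow]; simp
      simp only [Fin.val_zero, Fin.val_last, pow_zero, Nat.succ_eq_add_one]
      linear_combination (∏ i : Fin (n + 1), ψ i.succ) * this
    · intro i _
      have e : bidiagWithOnesRow (n + 2) ψ i.castSucc.succ 0 = 0 := by
        have := i.2
        simp [bidiagWithOnesRow, Fin.ext_iff]
      rw [e]; simp

/-- Determinant identity (54)/(70): `det Ψ̃ = ∑_j ∏_{i ≠ j} ψ i`; in particular, if all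
`ψ i > 0`, then `det Ψ̃ = (∏ ψ i) · (∑ 1/ψ i) > 0`. -/
theorem det_bidiagWithOnesRow {n : ℕ} (hn : 1 ≤ n) (ψ : Fin n → ℝ) :
    (bidiagWithOnesRow n ψ).det = (∑ j : Fin n, ∏ i ∈ Finset.univ.erase j, ψ i) ∧
      ((∀ i, 0 < ψ i) →
        (bidiagWithOnesRow n ψ).det = (∏ i, ψ i) * ∑ i, (ψ i)⁻¹ ∧
          0 < (bidiagWithOnesRow n ψ).det) := by
  obtain ⟨m, rfl⟩ : ∃ m, n = m + 1 := ⟨n - 1, by omega⟩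
  refine ⟨aux_det ψ, fun h => ?_⟩
  have key : (bidiagWithOnesRow (m + 1) ψ).det = (∏ i, ψ i) * ∑ i, (ψ i)⁻¹ := by
    rw [aux_det, Finset.mul_sum]
    apply Finset.sum_congr rfl
    intro j _
    rw [← Finset.mul_prod_erase Finset.univ ψ (Finset.mem_univ j)]
    have := (h j).ne'
    field_simp
  refine ⟨key, ?_⟩
  rw [key]
  exact mul_pos (Finset.prod_pos fun i _ => h i)
    (Finset.sum_pos (fun i _ => inv_pos.mpr (h i)) Finset.univ_nonempty)
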